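/- Let 𝒜 be a semi-abelian category and let 0→K→X→Y→0 be a short exact sequence, with kernel k: K→X and regular epimorphism f: X→Y, such that f is a central extension. Let A be an abelian object and r: K→A a regular epimorphism. Then there exists a central extension p: Z→Y with kernel l: A→Z, together with a regular epimorphism r̄: X→Z such that p∘r̄ = f and r̄∘k = l∘r. -/

import Mathlib

open CategoryTheory CategoryTheory.Limits

universe v u

section Defs

variable {C : Type u} [Category.{v} C]

/-- A finitely complete category is protomodular if, for every commutative diagram of two
adjacent commutative squares in which the middle vertical morphism is a split epimorphism,
whenever the left-hand square and the outer rectangle are pullbacks, so is the right-hand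
square. -/
def Protomodular (C : Type u) [Category.{v} C] : Prop :=
  ∀ ⦃A B D A' B' D' : C⦄ (f : A ⟶ B) (g : B ⟶ D)
    (f' : A' ⟶ B') (g' : B' ⟶ D')
    (a : A ⟶ A') (b : B ⟶ B') (d : D ⟶ D'),
    g ≫ d = b ≫ g' →
    IsSplitEpi b →
    IsPullback f a b f' →
    IsPullback (f ≫ g) a d (f' ≫ g') →
    IsPullback g b d g'

variable [HasZeroMorphisms C] [HasFiniteLimits C]

/-- Two coterminal morphisms `k`, `k'` cooperate (commute in the sense of Huq) when there is
a morphism `φ : K ⨯ K' ⟶ X` restricting to `k` and `k'` along `(1,0)` and `(0,1)`. -/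
def Cooperate {K K' X : C} (k : K ⟶ X) (k' : K' ⟶ X) : Prop :=
  ∃ φ : K ⨯ K' ⟶ X, prod.lift (𝟙 K) 0 ≫ φ = k ∧ prod.lift 0 (𝟙 K') ≫ φ = k'

/-- A morphism is central in the sense of Huq when it cooperates with the identity. -/
def HuqCentral {K X : C} (k : K ⟶ X) : Prop :=
  Cooperate k (𝟙 X)

/-- An object is abelian when its identity cooperates with itself. -/
def IsAbelianObj (A : C) : Prop :=
  Cooperate (𝟙 A) (𝟙 A)

/-- `k` is a kernel of `f`. -/
def IsKernelOf {K X Y : C} (k : K ⟶ X) (f : X ⟶ Y) : Prop :=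
  ∃ w : k ≫ f = 0, Nonempty (IsLimit (KernelFork.ofι k w))

/-- A central extension is a regular epimorphism whose kernel is Huq-central. -/
def IsCentralExt {X Y : C} (f : X ⟶ Y) : Prop :=
  Nonempty (RegularEpi f) ∧ HuqCentral (kernel.ι f)

/-- A normal monomorphism: a morphism that is a kernel of some morphism. -/
def IsNormalMonoP {K X : C} (m : K ⟶ X) : Prop :=
  ∃ (Z : C) (g : X ⟶ Z), IsKernelOf m g

/-- `(p₁, p₂) : R ↣ X ⨯ X` is an internal equivalence relation. -/
structure IsEquivRelation {R X : C} (p₁ p₂ : R ⟶ X) : Prop where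
  mono : Mono (prod.lift p₁ p₂)
  refl : ∃ d : X ⟶ R, d ≫ p₁ = 𝟙 X ∧ d ≫ p₂ = 𝟙 X
  symm : ∃ s : R ⟶ R, s ≫ p₁ = p₂ ∧ s ≫ p₂ = p₁
  trans : ∃ t : pullback p₂ p₁ ⟶ R,
    t ≫ p₁ = pullback.fst p₂ p₁ ≫ p₁ ∧ t ≫ p₂ = pullback.snd p₂ p₁ ≫ p₂

end Defs

/-- A semi-abelian category: pointed, Barr-exact (regular with effective equivalence
relations), protomodular and with binary coproducts. -/
class SemiAbelian (C : Type u) [Category.{v} C] [HasZeroMorphisms C] [HasZeroObject C]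
    [HasFiniteLimits C] [HasBinaryCoproducts C] : Prop where
  /-- Every kernel pair has a coequalizer. -/
  hasCoeqOfKernelPair : ∀ {X Y : C} (f : X ⟶ Y),
    HasCoequalizer (pullback.fst f f) (pullback.snd f f)
  /-- Regular epimorphisms are stable under pullback. -/
  regEpiPullbackStable : ∀ {X Y Z : C} (f : X ⟶ Z) (g : Y ⟶ Z),
    Nonempty (RegularEpi g) → Nonempty (RegularEpi (pullback.fst f g))
  /-- Every internal equivalence relation is effective, i.e. a kernel pair. -/
  equivRelationEffective : ∀ {R X : C} (p₁ p₂ : R ⟶ X), IsEquivRelation p₁ p₂ →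
    ∃ (Y : C) (f : X ⟶ Y), IsKernelPair f p₁ p₂
  /-- The category is protomodular. -/
  protomodular : Protomodular C

attribute [local simp] prod.lift_fst prod.lift_snd prod.lift_fst_assoc prod.lift_snd_assoc

section Kernels

variable {C : Type u} [Category.{v} C] [HasZeroMorphisms C] {K X Y : C} {k : K ⟶ X} {f : X ⟶ Y}

lemma IsKernelOf.of_exists_lift [Mono k] (w : k ≫ f = 0)
    (h : ∀ ⦃T : C⦄ (t : T ⟶ X), t ≫ f = 0 → ∃ s, s ≫ k = t) : IsKernelOf k f :=
  ⟨w, ⟨KernelFork.IsLimit.ofι' k w fun t ht => ⟨(h t ht).choose, (h t ht).choose_spec⟩⟩⟩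

lemma IsKernelOf.comp_eq_zero (h : IsKernelOf k f) : k ≫ f = 0 := h.1

lemma IsKernelOf.mono (h : IsKernelOf k f) : Mono k :=
  ⟨fun _ _ e => Fork.IsLimit.hom_ext h.2.some e⟩

lemma IsKernelOf.exists_lift (h : IsKernelOf k f) {T : C} (t : T ⟶ X) (ht : t ≫ f = 0) :
    ∃ s, s ≫ k = t :=
  ⟨_, (KernelFork.IsLimit.lift' h.2.some t ht).2⟩

lemma isKernelOf_kernel_ι (f : X ⟶ Y) [HasKernel f] : IsKernelOf (kernel.ι f) f :=
  IsKernelOf.of_exists_lift (kernel.condition f) fun _ t ht =>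
    ⟨kernel.lift f t ht, kernel.lift_ι f t ht⟩

lemma IsKernelOf.exists_iso {K' : C} {k' : K' ⟶ X} (h : IsKernelOf k f) (h' : IsKernelOf k' f) :
    ∃ e : K ≅ K', e.hom ≫ k' = k := by
  obtain ⟨s, hs⟩ := h'.exists_lift k h.comp_eq_zero
  obtain ⟨t, ht⟩ := h.exists_lift k' h'.comp_eq_zero
  have := h.mono
  have := h'.mono
  exact ⟨⟨s, t, by simp [← cancel_mono k, hs, ht], by simp [← cancel_mono k', hs, ht]⟩, hs⟩

lemma IsKernelOf.isPullback (h : IsKernelOf k f) {O : C} (hO : IsZero O) :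
    IsPullback k (0 : K ⟶ O) f (0 : O ⟶ Y) := by
  have := h.mono
  refine ⟨⟨by simp [h.comp_eq_zero]⟩, ⟨PullbackCone.IsLimit.mk _
    (fun s => (h.exists_lift s.fst (by simpa using s.condition)).choose)
    (fun s => (h.exists_lift s.fst (by simpa using s.condition)).choose_spec)
    (fun s => hO.eq_of_tgt _ _) fun s m hm _ => ?_⟩⟩
  rw [← cancel_mono k, hm, (h.exists_lift s.fst (by simpa using s.condition)).choose_spec]

end Kernels

section Cooperation

variable {C : Type u} [Category.{v} C] [HasZeroMorphisms C] [HasFiniteLimits C]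

lemma Cooperate.symm {K K' X : C} {k : K ⟶ X} {k' : K' ⟶ X} (h : Cooperate k k') :
    Cooperate k' k := by
  obtain ⟨φ, h₁, h₂⟩ := h
  refine ⟨prod.lift prod.snd prod.fst ≫ φ, ?_, ?_⟩
  · rw [← h₂, ← Category.assoc]
    congr 1
    ext <;> simp
  · rw [← h₁, ← Category.assoc]
    congr 1
    ext <;> simp

lemma Cooperate.comp {K K' X Y : C} {k : K ⟶ X} {k' : K' ⟶ X} (h : Cooperate k k')
    (f : X ⟶ Y) : Cooperate (k ≫ f) (k' ≫ f) := by
  obtain ⟨φ, rfl, rfl⟩ := h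
  exact ⟨φ ≫ f, by simp, by simp⟩

lemma Cooperate.precomp_left {K K' L X : C} {k : K ⟶ X} {k' : K' ⟶ X} (h : Cooperate k k')
    (g : L ⟶ K) : Cooperate (g ≫ k) k' := by
  obtain ⟨φ, rfl, rfl⟩ := h
  refine ⟨prod.map g (𝟙 _) ≫ φ, ?_, ?_⟩
  · rw [← Category.assoc, ← Category.assoc]
    congr 1
    ext <;> simp
  · rw [← Category.assoc]
    congr 1
    ext <;> simp

lemma isKernelOf_prod_snd (K X : C) :
    IsKernelOf (prod.lift (𝟙 K) (0 : K ⟶ X)) (prod.snd : K ⨯ X ⟶ X) := by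
  have : Mono (prod.lift (𝟙 K) (0 : K ⟶ X)) := mono_of_mono_fac (prod.lift_fst (𝟙 K) (0 : K ⟶ X))
  refine IsKernelOf.of_exists_lift (by simp) fun T t ht => ⟨t ≫ prod.fst, ?_⟩
  ext <;> simp [ht]

variable [HasZeroObject C]

open ZeroObject

lemma Protomodular.prod_hom_ext (hC : Protomodular C) {K X W : C} {a b : K ⨯ X ⟶ W}
    (h₁ : prod.lift (𝟙 K) 0 ≫ a = prod.lift (𝟙 K) 0 ≫ b)
    (h₂ : prod.lift 0 (𝟙 X) ≫ a = prod.lift 0 (𝟙 X) ≫ b) : a = b := by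
  let e := equalizer.ι a b
  let i : K ⟶ equalizer a b := equalizer.lift _ h₁
  let s : X ⟶ equalizer a b := equalizer.lift _ h₂
  have hi : i ≫ e = prod.lift (𝟙 K) 0 := equalizer.lift_ι _ h₁
  have hs : s ≫ e = prod.lift 0 (𝟙 X) := equalizer.lift_ι _ h₂
  have hker := isKernelOf_prod_snd K X
  have hker' : IsKernelOf i (e ≫ prod.snd) := by
    have : Mono (i ≫ e) := hi ▸ hker.mono
    have : Mono i := mono_of_mono i e
    refine IsKernelOf.of_exists_lift (by rw [← Category.assoc, hi, hker.comp_eq_zero])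
      fun T t ht => ?_
    obtain ⟨s, hs⟩ := hker.exists_lift (t ≫ e) (by simpa using ht)
    exact ⟨s, by rw [← cancel_mono e, Category.assoc, hi, hs]⟩
  have hsplit : IsSplitEpi (e ≫ (prod.snd : K ⨯ X ⟶ X)) :=
    ⟨⟨⟨s, by rw [← Category.assoc, hs, prod.lift_snd]⟩⟩⟩
  have hpb := hC i e (0 : (0 : C) ⟶ X) (𝟙 X) 0 (e ≫ prod.snd) prod.snd (by simp) hsplit
    (hker'.isPullback (isZero_zero C))
    (by rw [hi, Category.comp_id]; exact hker.isPullback (isZero_zero C))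
  have : IsIso e := hpb.isIso_fst_of_isIso
  rw [← cancel_epi e]
  exact equalizer.condition a b

/-- For a central kernel `k` of `f`, with action `φ`, the action groupoid of `φ` is the kernel
pair of `f`. -/
lemma Protomodular.isPullback_action (hC : Protomodular C) {K X Y : C} {k : K ⟶ X} {f : X ⟶ Y}
    (hk : IsKernelOf k f) {φ : K ⨯ X ⟶ X} (h₁ : prod.lift (𝟙 K) 0 ≫ φ = k)
    (h₂ : prod.lift 0 (𝟙 X) ≫ φ = 𝟙 X) : IsPullback φ prod.snd f f := by
  have hsplit : IsSplitEpi (prod.snd : K ⨯ X ⟶ X) := ⟨⟨⟨prod.lift 0 (𝟙 X), by simp⟩⟩⟩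
  refine hC (prod.lift (𝟙 K) 0) φ (0 : (0 : C) ⟶ X) f 0 prod.snd f ?_ hsplit
    ((isKernelOf_prod_snd K X).isPullback (isZero_zero C)) ?_
  · refine hC.prod_hom_ext ?_ ?_
    · rw [← Category.assoc, h₁, hk.comp_eq_zero]
      simp
    · rw [← Category.assoc, h₂]
      simp
  · rw [h₁, zero_comp]
    exact hk.isPullback (isZero_zero C)

/-- A central monomorphism `k` with action `φ` restricts to a multiplication on its domain
which is a cooperator for the identities. -/
lemma Protomodular.exists_multiplication (hC : Protomodular C) {K X Y : C} {k : K ⟶ X}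
    {f : X ⟶ Y} (hk : IsKernelOf k f) {φ : K ⨯ X ⟶ X} (h₁ : prod.lift (𝟙 K) 0 ≫ φ = k)
    (h₂ : prod.lift 0 (𝟙 X) ≫ φ = 𝟙 X) :
    ∃ m : K ⨯ K ⟶ K, m ≫ k = prod.map (𝟙 K) k ≫ φ ∧
      prod.lift (𝟙 K) 0 ≫ m = 𝟙 K ∧ prod.lift 0 (𝟙 K) ≫ m = 𝟙 K := by
  have := hk.mono
  obtain ⟨m, hm⟩ := hk.exists_lift (prod.map (𝟙 K) k ≫ φ) (by
    rw [Category.assoc, (hC.isPullback_action hk h₁ h₂).w]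
    simp [hk.comp_eq_zero])
  refine ⟨m, hm, ?_, ?_⟩
  · rw [← cancel_mono k, Category.assoc, hm, Category.id_comp, ← Category.assoc]
    simpa using h₁
  · have : prod.lift 0 (𝟙 K) ≫ prod.map (𝟙 K) k = k ≫ prod.lift 0 (𝟙 X) := by ext <;> simp
    rw [← cancel_mono k, Category.assoc, hm, Category.id_comp, reassoc_of% this, h₂,
      Category.comp_id]

/-- The action on `X` of a subobject `N` of a central kernel `K`, when `N` is itself a kernel,
is an equivalence relation. -/
lemma Protomodular.isEquivRelation_action (hC : Protomodular C) {N K X Y A : C} {k : K ⟶ X}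
    {f : X ⟶ Y} (hk : IsKernelOf k f) {φ : K ⨯ X ⟶ X} (h₁ : prod.lift (𝟙 K) 0 ≫ φ = k)
    (h₂ : prod.lift 0 (𝟙 X) ≫ φ = 𝟙 X) {ν : N ⟶ K} {r : K ⟶ A} (hν : IsKernelOf ν r) :
    IsEquivRelation (prod.snd : N ⨯ X ⟶ X) (prod.map ν (𝟙 X) ≫ φ) := by
  have := hν.mono
  have hpb := hC.isPullback_action hk h₁ h₂
  obtain ⟨m, hm, hm₁, hm₂⟩ := hC.exists_multiplication hk h₁ h₂
  have act_assoc {T : C} (a b : T ⟶ K) (x : T ⟶ X) :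
      prod.lift a (prod.lift b x ≫ φ) ≫ φ = prod.lift (prod.lift a b ≫ m) x ≫ φ := by
    have key : prod.map (𝟙 K) φ ≫ φ =
        prod.lift (prod.map (𝟙 K) prod.fst ≫ m) (prod.snd ≫ prod.snd) ≫ φ := by
      refine hC.prod_hom_ext ?_ ?_
      · have e₁ : prod.lift (𝟙 K) 0 ≫ prod.map (𝟙 K) φ = prod.lift (𝟙 K) 0 := by ext <;> simp
        have e₂ : prod.lift (𝟙 K) (0 : K ⟶ K ⨯ X) ≫
            prod.lift (prod.map (𝟙 K) prod.fst ≫ m) (prod.snd ≫ prod.snd) =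
            prod.lift (𝟙 K) 0 := by
          ext <;> simp [hm₁]
        rw [reassoc_of% e₁, reassoc_of% e₂]
      · have e₁ : prod.lift 0 (𝟙 (K ⨯ X)) ≫ prod.map (𝟙 K) φ = φ ≫ prod.lift 0 (𝟙 X) := by
          ext <;> simp
        have e₃ : prod.lift (0 : K ⨯ X ⟶ K) (prod.fst : K ⨯ X ⟶ K) =
            prod.fst ≫ prod.lift 0 (𝟙 K) := by
          ext <;> simp
        have e₄ : prod.lift (0 : K ⨯ X ⟶ K) (prod.fst : K ⨯ X ⟶ K) ≫ m = prod.fst := by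
          rw [e₃, Category.assoc, hm₂, Category.comp_id]
        have e₂ : prod.lift 0 (𝟙 (K ⨯ X)) ≫
            prod.lift (prod.map (𝟙 K) prod.fst ≫ m) (prod.snd ≫ prod.snd) = 𝟙 _ := by
          ext <;> simp [e₄]
        rw [reassoc_of% e₁, reassoc_of% e₂, h₂, Category.comp_id]
    have e : prod.lift a (prod.lift b x) ≫
        prod.lift (prod.map (𝟙 K) prod.fst ≫ m) (prod.snd ≫ prod.snd) =
        prod.lift (prod.lift a b ≫ m) x := by
      ext <;> simp
    rw [← e, Category.assoc, ← key]
    simp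
  have mul_right {T : C} (a : T ⟶ K) (n : T ⟶ N) :
      prod.lift a (n ≫ ν) ≫ m ≫ r = a ≫ r := by
    have key : prod.map (𝟙 K) ν ≫ m ≫ r = prod.fst ≫ r := by
      refine hC.prod_hom_ext ?_ ?_
      · have e : prod.lift (𝟙 K) 0 ≫ prod.map (𝟙 K) ν = prod.lift (𝟙 K) 0 := by ext <;> simp
        rw [reassoc_of% e, reassoc_of% hm₁]
        simp
      · have e : prod.lift 0 (𝟙 N) ≫ prod.map (𝟙 K) ν = ν ≫ prod.lift 0 (𝟙 K) := by
          ext <;> simp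
        rw [reassoc_of% e, reassoc_of% hm₂, hν.comp_eq_zero]
        simp
    simpa using prod.lift a n ≫= key
  have act_zero {T : C} (x : T ⟶ X) : prod.lift 0 x ≫ φ = x := by
    have e : prod.lift (0 : T ⟶ K) x = x ≫ prod.lift 0 (𝟙 X) := by ext <;> simp
    rw [e, Category.assoc, h₂, Category.comp_id]
  have map_eq {T : C} (t : T ⟶ N ⨯ X) : t ≫ prod.map ν (𝟙 X) =
      prod.lift (t ≫ prod.fst ≫ ν) (t ≫ prod.snd) := by ext <;> simp
  have map_eq' : prod.map ν (𝟙 X) = prod.lift (prod.fst ≫ ν) prod.snd := by ext <;> simp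
  constructor
  · refine ⟨fun s t hst => ?_⟩
    have e₁ := hst =≫ prod.fst
    have e₂ := hst =≫ prod.snd
    simp only [Category.assoc, prod.lift_fst, prod.lift_snd] at e₁ e₂
    have : s ≫ prod.map ν (𝟙 X) = t ≫ prod.map ν (𝟙 X) :=
      hpb.hom_ext (by simpa using e₂) (by simpa using e₁)
    rwa [cancel_mono] at this
  · refine ⟨prod.lift 0 (𝟙 X), by simp, ?_⟩
    rw [← Category.assoc, map_eq]
    simp [act_zero]
  · have hf : prod.snd ≫ f = (prod.map ν (𝟙 X) ≫ φ) ≫ f := by simp [hpb.w]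
    let t := hpb.lift prod.snd (prod.map ν (𝟙 X) ≫ φ) hf
    have ht₁ : t ≫ φ = prod.snd := hpb.lift_fst _ _ hf
    have ht₂ : t ≫ prod.snd = prod.map ν (𝟙 X) ≫ φ := hpb.lift_snd _ _ hf
    have ht : t = prod.lift (t ≫ prod.fst) (prod.lift (prod.fst ≫ ν) prod.snd ≫ φ) := by
      ext
      · simp
      · rw [prod.lift_snd, ht₂, map_eq']
    have hmul : prod.lift (t ≫ prod.fst) (prod.fst ≫ ν) ≫ m = 0 := by
      have e : prod.lift (prod.lift (t ≫ prod.fst) (prod.fst ≫ ν) ≫ m) prod.snd =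
          prod.lift 0 (prod.snd : N ⨯ X ⟶ X) := by
        refine hpb.hom_ext ?_ (by simp)
        rw [← act_assoc, ← ht, ht₁, act_zero]
      simpa using e =≫ prod.fst
    obtain ⟨n, hn⟩ := hν.exists_lift (t ≫ prod.fst) (by
      rw [← mul_right _ prod.fst, reassoc_of% hmul, zero_comp])
    refine ⟨prod.lift n (prod.map ν (𝟙 X) ≫ φ), by simp, ?_⟩
    have e : prod.lift n (prod.map ν (𝟙 X) ≫ φ) ≫ prod.map ν (𝟙 X) = t := by
      ext
      · simp [hn]
      · simp [ht₂]
    rw [← Category.assoc, e, ht₁]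
  · let a := pullback.fst (prod.map ν (𝟙 X) ≫ φ) (prod.snd : N ⨯ X ⟶ X)
    let b := pullback.snd (prod.map ν (𝟙 X) ≫ φ) (prod.snd : N ⨯ X ⟶ X)
    have hab : a ≫ prod.map ν (𝟙 X) ≫ φ = b ≫ prod.snd := pullback.condition
    obtain ⟨n, hn⟩ := hν.exists_lift (prod.lift (b ≫ prod.fst ≫ ν) (a ≫ prod.fst ≫ ν) ≫ m) (by
      have := mul_right (b ≫ prod.fst ≫ ν) (a ≫ prod.fst)
      simp only [Category.assoc] at this ⊢
      simp [this, hν.comp_eq_zero])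
    refine ⟨prod.lift n (a ≫ prod.snd), by simp [a], ?_⟩
    change _ = b ≫ _
    rw [← Category.assoc, ← Category.assoc, map_eq, map_eq b, ← hab, ← Category.assoc a, map_eq a,
      act_assoc, ← hn]
    simp

end Cooperation

section SemiAbelian

variable {C : Type u} [Category.{v} C] [HasZeroMorphisms C] [HasZeroObject C]
  [HasFiniteLimits C] [HasBinaryCoproducts C] [SemiAbelian C]

lemma SemiAbelian.regular : Regular C where
  hasCoequalizer_of_isKernelPair {X Y Z f g₁ g₂} h := by
    have := SemiAbelian.hasCoeqOfKernelPair f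
    have e : parallelPair g₁ g₂ ≅ parallelPair (pullback.fst f f) (pullback.snd f f) :=
      parallelPair.ext h.isoPullback (Iso.refl X)
        ((Category.comp_id _).trans h.isoPullback_hom_fst.symm)
        ((Category.comp_id _).trans h.isoPullback_hom_snd.symm)
    exact hasColimit_of_iso e
  regularEpiIsStableUnderBaseChange := .mk' fun X Y S f g _ hg =>
    ⟨SemiAbelian.regEpiPullbackStable f g hg.1⟩

lemma Cooperate.of_regularEpi_right {K X X' W : C} {a : K ⟶ W} {g : X ⟶ X'} {t : X' ⟶ W}
    [IsRegularEpi g] (h : Cooperate a (g ≫ t)) : Cooperate a t := by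
  have := SemiAbelian.regular (C := C)
  have hC : Protomodular C := SemiAbelian.protomodular
  obtain ⟨φ, h₁, h₂⟩ := h
  have hpb : IsPullback prod.snd (prod.map (𝟙 K) g) g prod.snd := by
    refine ⟨⟨by simp⟩, ⟨PullbackCone.IsLimit.mk _
      (fun s => prod.lift (s.snd ≫ prod.fst) s.fst) (by simp) ?_ ?_⟩⟩
    · intro s
      ext
      · simp
      · simpa using s.condition
    · intro s m hm₁ hm₂
      ext
      · simp [← hm₂]
      · simpa using hm₁
  have hreg : IsRegularEpi (prod.map (𝟙 K) g) :=
    Regular.regularEpiIsStableUnderBaseChange.of_isPullback hpb ‹IsRegularEpi g›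
  let G := pullback g g
  have key : prod.map (𝟙 K) (pullback.fst g g) ≫ φ = prod.map (𝟙 K) (pullback.snd g g) ≫ φ := by
    have e₁ (s : G ⟶ X) : prod.lift (𝟙 K) 0 ≫ prod.map (𝟙 K) s = prod.lift (𝟙 K) 0 := by
      ext <;> simp
    have e₂ (s : G ⟶ X) :
        prod.lift 0 (𝟙 G) ≫ prod.map (𝟙 K) s = s ≫ prod.lift 0 (𝟙 X) := by
      ext <;> simp
    refine hC.prod_hom_ext ?_ ?_
    · rw [reassoc_of% e₁, reassoc_of% e₁]
    · rw [reassoc_of% e₂, reassoc_of% e₂, h₂, pullback.condition_assoc]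
  obtain ⟨ψ, hψ⟩ := IsRegularEpi.exists_of_isKernelPair (prod.map (𝟙 K) g)
    (IsKernelPair.of_hasPullback _) φ (by
      let P := pullback (prod.map (𝟙 K) g) (prod.map (𝟙 K) g)
      let c₁ : P ⟶ K ⨯ X := pullback.fst _ _
      let c₂ : P ⟶ K ⨯ X := pullback.snd _ _
      have hc : c₁ ≫ prod.map (𝟙 K) g = c₂ ≫ prod.map (𝟙 K) g := pullback.condition
      have hc₁ : c₁ ≫ prod.fst = c₂ ≫ prod.fst := by simpa using hc =≫ prod.fst
      have hc₂ : (c₁ ≫ prod.snd) ≫ g = (c₂ ≫ prod.snd) ≫ g := by simpa using hc =≫ prod.snd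
      obtain ⟨d, hd₁, hd₂⟩ := (IsKernelPair.of_hasPullback g).lift' _ _ hc₂
      have l₁ : prod.lift (c₁ ≫ prod.fst) d ≫ prod.map (𝟙 K) (pullback.fst g g) = c₁ := by
        ext <;> simp [hd₁]
      have l₂ : prod.lift (c₁ ≫ prod.fst) d ≫ prod.map (𝟙 K) (pullback.snd g g) = c₂ := by
        ext <;> simp [hc₁, hd₂]
      change c₁ ≫ φ = c₂ ≫ φ
      rw [← l₁, ← l₂, Category.assoc, Category.assoc, key])
  refine ⟨ψ, ?_, ?_⟩
  · have e : prod.lift (𝟙 K) 0 ≫ prod.map (𝟙 K) g = prod.lift (𝟙 K) 0 := by ext <;> simp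
    rw [← h₁, ← hψ, reassoc_of% e]
  · have : Epi g := inferInstance
    have e : prod.lift 0 (𝟙 X) ≫ prod.map (𝟙 K) g = g ≫ prod.lift 0 (𝟙 X') := by ext <;> simp
    rw [← cancel_epi g, ← h₂, ← hψ, reassoc_of% e]

/-- Equivalence relations in a semi-abelian category are kernel pairs of regular epimorphisms. -/
lemma SemiAbelian.exists_quotient {R X : C} {p₁ p₂ : R ⟶ X} (h : IsEquivRelation p₁ p₂) :
    ∃ (Z : C) (q : X ⟶ Z), IsRegularEpi q ∧ IsKernelPair q p₁ p₂ := by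
  have := SemiAbelian.regular (C := C)
  obtain ⟨Y, f, hf⟩ := SemiAbelian.equivRelationEffective p₁ p₂ h
  have := Regular.hasCoequalizer_of_isKernelPair hf
  refine ⟨coequalizer p₁ p₂, coequalizer.π p₁ p₂, inferInstance, ?_⟩
  have e : coequalizer.π p₁ p₂ ≫ coequalizer.desc f hf.w = f := coequalizer.π_desc _ _
  rw [← e] at hf
  exact hf.cancel_right (coequalizer.condition p₁ p₂)

/-- In a regular category, generalized elements lift along a regular epimorphism after passing to
a cover. -/
lemma CategoryTheory.Regular.exists_epi_comp_eq {D : Type u} [Category.{v} D] [Regular D]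
    {K A T : D} (r : K ⟶ A) [IsRegularEpi r] (x : T ⟶ A) :
    ∃ (S : D) (c : S ⟶ T) (y : S ⟶ K), Epi c ∧ y ≫ r = c ≫ x :=
  ⟨_, pullback.fst x r, pullback.snd x r, inferInstance, pullback.condition.symm⟩

end SemiAbelian

/-- Given a central extension `f : X ⟶ Y` with kernel `k : K ⟶ X`, an abelian object `A`
and a regular epimorphism `r : K ⟶ A`, there is a central extension of `Y` by `A`
making the diagram commutative, via a regular epimorphism `X ⟶ Z`. -/
theorem statement7 {C : Type u} [Category.{v} C] [HasZeroMorphisms C] [HasZeroObject C]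
    [HasFiniteLimits C] [HasBinaryCoproducts C] [SemiAbelian C]
    {K X Y : C} (k : K ⟶ X) (f : X ⟶ Y)
    (hk : IsKernelOf k f) (hf : IsCentralExt f)
    {A : C} (hA : IsAbelianObj A)
    (r : K ⟶ A) (hr : Nonempty (RegularEpi r)) :
    ∃ (Z : C) (p : Z ⟶ Y) (l : A ⟶ Z) (rbar : X ⟶ Z),
      IsCentralExt p ∧ IsKernelOf l p ∧ Nonempty (RegularEpi rbar) ∧
        rbar ≫ p = f ∧ k ≫ rbar = r ≫ l := by
  have := SemiAbelian.regular (C := C)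
  have hC : Protomodular C := SemiAbelian.protomodular
  have : IsRegularEpi f := ⟨hf.1⟩
  have : IsRegularEpi r := ⟨hr⟩
  have := hk.mono
  have hkc : HuqCentral k := by
    obtain ⟨e, rfl⟩ := hk.exists_iso (isKernelOf_kernel_ι f)
    exact hf.2.precomp_left e.hom
  obtain ⟨φ, h₁, h₂⟩ := id hkc
  obtain ⟨N, ν, hν⟩ : ∃ (N : C) (ν : N ⟶ K), IsKernelOf ν r := ⟨_, _, isKernelOf_kernel_ι r⟩
  have hpb := hC.isPullback_action hk h₁ h₂
  obtain ⟨m, hm, hm₁, hm₂⟩ := hC.exists_multiplication hk h₁ h₂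
  obtain ⟨Z, q, hq, hqk⟩ := SemiAbelian.exists_quotient (hC.isEquivRelation_action hk h₁ h₂ hν)
  have hrk : IsKernelPair r (prod.map ν (𝟙 K) ≫ m) prod.snd := by
    refine hC.isPullback_action hν ?_ ?_
    · have e : prod.lift (𝟙 _) 0 ≫ prod.map ν (𝟙 K) = ν ≫ prod.lift (𝟙 K) 0 := by ext <;> simp
      rw [reassoc_of% e, hm₁, Category.comp_id]
    · have e : prod.lift 0 (𝟙 K) ≫ prod.map ν (𝟙 K) = prod.lift 0 (𝟙 K) := by ext <;> simp
      rw [reassoc_of% e, hm₂]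
  have hmk : (prod.map ν (𝟙 K) ≫ m) ≫ k = prod.map (𝟙 _) k ≫ prod.map ν (𝟙 X) ≫ φ := by
    rw [Category.assoc, hm]
    simp
  obtain ⟨p, hp⟩ := IsRegularEpi.exists_of_isKernelPair q hqk f (by simp [hpb.w])
  obtain ⟨l, hl⟩ := IsRegularEpi.exists_of_isKernelPair r hrk (k ≫ q) (by
    rw [← Category.assoc, hmk, Category.assoc, ← hqk.w]
    simp)
  have : StrongEpi (q ≫ p) := hp ▸ inferInstance
  have : StrongEpi p := strongEpi_of_strongEpi q p
  have hpreg : IsRegularEpi p := inferInstance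
  have hlp : l ≫ p = 0 := by
    rw [← cancel_epi r, reassoc_of% hl, hp, hk.comp_eq_zero, comp_zero]
  have hlmono : Mono l := by
    refine ⟨fun {T} x y hxy => ?_⟩
    obtain ⟨T₁, c, x₁, _, hx₁⟩ := Regular.exists_epi_comp_eq r x
    obtain ⟨T₂, d, y', _, hy⟩ := Regular.exists_epi_comp_eq r (c ≫ y)
    obtain ⟨x', hx'⟩ : ∃ x', x' = d ≫ x₁ := ⟨_, rfl⟩
    have hx : x' ≫ r = d ≫ c ≫ x := by rw [hx', Category.assoc, hx₁]
    rw [← cancel_epi c, ← cancel_epi d, ← hx, ← hy]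
    obtain ⟨z, hz₁, hz₂⟩ := hqk.lift' (x' ≫ k) (y' ≫ k) (by
      rw [Category.assoc, Category.assoc, ← hl, reassoc_of% hx, reassoc_of% hy, hxy])
    have hw : prod.lift (z ≫ prod.fst) x' ≫ prod.map (𝟙 N) k = z := by ext <;> simp [hz₁]
    have hw₁ : prod.lift (z ≫ prod.fst) x' ≫ prod.map ν (𝟙 K) ≫ m = y' := by
      rw [← cancel_mono k, Category.assoc, hmk, reassoc_of% hw, hz₂]
    rw [← hw₁, Category.assoc, hrk.w]
    simp
  have hker : IsKernelOf l p := by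
    obtain ⟨j, hj⟩ := (isKernelOf_kernel_ι p).exists_lift l hlp
    have : Mono (j ≫ kernel.ι p) := hj ▸ hlmono
    have : Mono j := mono_of_mono j (kernel.ι p)
    obtain ⟨s, hs⟩ := hk.exists_lift (pullback.snd (kernel.ι p) q) (by
      rw [← hp, ← pullback.condition_assoc, kernel.condition, comp_zero])
    have hsj : (s ≫ r) ≫ j = pullback.fst (kernel.ι p) q := by
      rw [← cancel_mono (kernel.ι p), Category.assoc, Category.assoc, hj, hl, reassoc_of% hs,
        pullback.condition]
    have : StrongEpi ((s ≫ r) ≫ j) := hsj ▸ inferInstance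
    have : StrongEpi j := strongEpi_of_strongEpi (s ≫ r) j
    have : IsIso j := isIso_of_mono_of_strongEpi j
    refine IsKernelOf.of_exists_lift hlp fun T t ht => ⟨kernel.lift p t ht ≫ inv j, ?_⟩
    rw [← hj]
    simp
  have hcentral : HuqCentral l := by
    have h : Cooperate (r ≫ l) (q ≫ 𝟙 Z) := by
      simpa [HuqCentral, hl] using hkc.comp q
    exact h.of_regularEpi_right.symm.of_regularEpi_right.symm
  refine ⟨Z, p, l, q, ⟨hpreg.1, ?_⟩, hker, hq.1, hp, hl.symm⟩
  obtain ⟨e, he⟩ := (isKernelOf_kernel_ι p).exists_iso hker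
  rw [← he]
  exact hcentral.precomp_left e.hom
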